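/- Let f be a finite nonnegative Borel measure on ℝ that is a Rajchman measure, i.e. its Fourier transform f̂(x) := ∫_ℝ e^{ixy} f(dy) tends to 0 as |x| → ∞. Let 0 < t₁ ≤ t₂. Then lim_{N→∞} (N/log N) · V_N = t₁ · f(ℝ), where V_N := N^{−2} ∫_{[0,N]²} ∫_0^{t₁} ∫_ℝ p_{2s(τ−s)/τ}((s/τ)(τ₂x₂ − τ₁x₁) − y) f(dy) ds dx₁ dx₂. -/

import Mathlib

open MeasureTheory

/-- One-dimensional heat kernel `p_t(x) = (2πt)^{-1/2} exp(-x²/(2t))`. -/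
noncomputable def heat1 (t x : ℝ) : ℝ :=
  (2 * Real.pi * t) ^ (-(1 : ℝ) / 2) * Real.exp (-x ^ 2 / (2 * t))

/-- `V_N = N⁻² ∫_{[0,N]²} ∫_0^{t₁} ∫_ℝ p_{2s(τ-s)/τ}((s/τ)(τ₂x₂ - τ₁x₁) - y) f(dy) ds dx₁ dx₂`
with `τ = 2t₁t₂/(t₁+t₂)`, `τ₁ = 2t₂/(t₁+t₂)`, `τ₂ = 2t₁/(t₁+t₂)`. -/
noncomputable def VN (f : Measure ℝ) (t₁ t₂ N : ℝ) : ℝ :=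
  let τ := 2 * t₁ * t₂ / (t₁ + t₂)
  let τ₁ := 2 * t₂ / (t₁ + t₂)
  let τ₂ := 2 * t₁ / (t₁ + t₂)
  (N ^ 2)⁻¹ * ∫ x₁ in Set.Icc (0 : ℝ) N, ∫ x₂ in Set.Icc (0 : ℝ) N,
    ∫ s in Set.Ioo (0 : ℝ) t₁,
      ∫ y, heat1 (2 * s * (τ - s) / τ) ((s / τ) * (τ₂ * x₂ - τ₁ * x₁) - y) ∂f

open Filter Topology

lemma heat1_eq (t x : ℝ) (ht : 0 ≤ t) :
    heat1 t x = (√(2 * Real.pi * t))⁻¹ * Real.exp (-x ^ 2 / (2 * t)) := by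
  unfold heat1
  rw [Real.sqrt_eq_rpow, ← Real.rpow_neg (by positivity)]
  norm_num

lemma heat1_nonneg {t : ℝ} (ht : 0 ≤ t) (x : ℝ) : 0 ≤ heat1 t x := by
  rw [heat1_eq t x ht]
  positivity

lemma heat1_le {t : ℝ} (ht : 0 ≤ t) (x : ℝ) : heat1 t x ≤ (√t)⁻¹ := by
  rw [heat1_eq t x ht]
  rcases ht.eq_or_lt with rfl | ht
  · simp
  have h1 : Real.exp (-x ^ 2 / (2 * t)) ≤ 1 := by
    rw [Real.exp_le_one_iff, neg_div]
    have : 0 ≤ x ^ 2 / (2 * t) := by positivity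
    linarith
  have h2 : (√(2 * Real.pi * t))⁻¹ ≤ (√t)⁻¹ := by
    gcongr
    nlinarith [Real.pi_gt_three]
  calc _ ≤ (√t)⁻¹ * 1 := by gcongr
    _ = _ := mul_one _

lemma heat1_le_inv_abs {t x : ℝ} (ht : 0 < t) (hx : x ≠ 0) : heat1 t x ≤ |x|⁻¹ := by
  rw [heat1_eq t x ht.le]
  have hx' : 0 < |x| := abs_pos.mpr hx
  have h2 : (√(2 * Real.pi * t))⁻¹ ≤ (√(2 * t))⁻¹ := by
    gcongr
    nlinarith [Real.pi_gt_three]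
  set r := |x| / √(2 * t) with hr
  have hs : 0 < √(2 * t) := by positivity
  have hr2 : x ^ 2 / (2 * t) = r ^ 2 := by
    rw [hr, div_pow, sq_abs, Real.sq_sqrt (by positivity)]
  have hexp : r * Real.exp (-r ^ 2) ≤ 1 := by
    have h3 := Real.add_one_le_exp (r ^ 2)
    rw [Real.exp_neg, ← div_eq_mul_inv, div_le_one (Real.exp_pos _)]
    nlinarith [sq_nonneg (r - 1)]
  rw [neg_div, hr2]
  calc _ ≤ (√(2 * t))⁻¹ * Real.exp (-r ^ 2) := by gcongr
    _ = |x|⁻¹ * (r * Real.exp (-r ^ 2)) := by rw [hr]; field_simp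
    _ ≤ |x|⁻¹ * 1 := by gcongr
    _ = _ := mul_one _

lemma heat1_eq_gaussianPDFReal {t : ℝ} (ht : 0 ≤ t) :
    heat1 t = ProbabilityTheory.gaussianPDFReal 0 t.toNNReal := by
  funext x
  rw [heat1_eq t x ht, ProbabilityTheory.gaussianPDFReal, sub_zero, Real.coe_toNNReal t ht]

lemma integrable_heat1 {t : ℝ} (ht : 0 < t) : Integrable (heat1 t) := by
  rw [heat1_eq_gaussianPDFReal ht.le]
  exact ProbabilityTheory.integrable_gaussianPDFReal _ _

lemma integral_heat1 {t : ℝ} (ht : 0 < t) : ∫ x, heat1 t x = 1 := by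
  rw [heat1_eq_gaussianPDFReal ht.le]
  exact ProbabilityTheory.integral_gaussianPDFReal_eq_one _ (Real.toNNReal_pos.mpr ht).ne'

lemma measurable_heat1 : Measurable fun p : ℝ × ℝ => heat1 p.1 p.2 := by
  unfold heat1
  fun_prop

lemma heat1_eq_scale {t : ℝ} (ht : 0 < t) (x : ℝ) :
    heat1 t x = (√t)⁻¹ * heat1 1 (x / √t) := by
  rw [heat1_eq t x ht.le, heat1_eq 1 _ zero_le_one, Real.sqrt_mul (by positivity), div_pow,
    Real.sq_sqrt ht.le]
  have : -x ^ 2 / (2 * t) = -(x ^ 2 / t) / (2 * 1) := by field_simp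
  rw [this, mul_one]
  field_simp

/-- The heat kernel integrated over an interval has mass at most one. -/
lemma intervalIntegral_heat1_mem {t a b : ℝ} (ht : 0 < t) (hab : a ≤ b) :
    0 ≤ ∫ x in a..b, heat1 t x ∧ ∫ x in a..b, heat1 t x ≤ 1 := by
  refine ⟨intervalIntegral.integral_nonneg hab fun x _ => heat1_nonneg ht.le x, ?_⟩
  rw [intervalIntegral.integral_of_le hab, ← integral_heat1 ht]
  exact setIntegral_le_integral (integrable_heat1 ht) (ae_of_all _ fun x => heat1_nonneg ht.le x)

lemma tendsto_intervalIntegral_heat1 {ι : Type*} {l : Filter ι} [l.IsCountablyGenerated]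
    {t a b : ι → ℝ} (ht : ∀ᶠ i in l, 0 < t i)
    (ha : Tendsto (fun i => a i / √(t i)) l atBot)
    (hb : Tendsto (fun i => b i / √(t i)) l atTop) :
    Tendsto (fun i => ∫ x in a i..b i, heat1 (t i) x) l (𝓝 1) := by
  have h := intervalIntegral_tendsto_integral (integrable_heat1 one_pos) ha hb
  rw [integral_heat1 one_pos] at h
  refine h.congr' ?_
  filter_upwards [ht] with i hi
  simp_rw [heat1_eq_scale hi]
  rw [intervalIntegral.integral_const_mul,
    intervalIntegral.integral_comp_div _ (Real.sqrt_pos.mpr hi).ne', smul_eq_mul,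
    inv_mul_cancel_left₀ (Real.sqrt_pos.mpr hi).ne']

lemma integral_swap_four {μ ν f : Measure ℝ} [IsFiniteMeasure μ] [SFinite ν] [IsFiniteMeasure f]
    {g : ℝ → ℝ → ℝ → ℝ → ℝ} {h : ℝ → ℝ}
    (hg : Measurable fun p : (ℝ × ℝ) × (ℝ × ℝ) => g p.1.1 p.1.2 p.2.1 p.2.2)
    (hh : Integrable h ν) (hgh : ∀ᵐ s ∂ν, ∀ x₁ x₂ y, ‖g x₁ x₂ s y‖ ≤ h s) :
    ∫ x₁, ∫ x₂, ∫ s, ∫ y, g x₁ x₂ s y ∂f ∂ν ∂μ ∂μ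
      = ∫ s, ∫ y, ∫ x₂, ∫ x₁, g x₁ x₂ s y ∂μ ∂μ ∂f ∂ν := by
  have hint : Integrable (fun p : (ℝ × ℝ) × (ℝ × ℝ) => g p.1.1 p.1.2 p.2.1 p.2.2)
      ((μ.prod μ).prod (ν.prod f)) := by
    have hb : Integrable (fun p : (ℝ × ℝ) × (ℝ × ℝ) => h p.2.1) ((μ.prod μ).prod (ν.prod f)) :=
      (hh.comp_fst f).comp_snd (μ.prod μ)
    refine hb.mono' hg.aestronglyMeasurable ?_
    have hq : Measure.QuasiMeasurePreserving (fun p : (ℝ × ℝ) × (ℝ × ℝ) => p.2.1)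
        ((μ.prod μ).prod (ν.prod f)) ν :=
      Measure.quasiMeasurePreserving_fst.comp Measure.quasiMeasurePreserving_snd
    filter_upwards [hq.ae hgh] with p hp using hp _ _ _
  have hin : ∀ x₁ x₂, Integrable (fun q : ℝ × ℝ => g x₁ x₂ q.1 q.2) (ν.prod f) := by
    intro x₁ x₂
    refine (hh.comp_fst f).mono'
      (hg.comp (measurable_prodMk_left (x := (x₁, x₂)))).aestronglyMeasurable ?_
    filter_upwards [(Measure.quasiMeasurePreserving_fst (μ := ν) (ν := f)).ae hgh] with q hq
      using hq _ _ _
  have hout := hint.integral_prod_left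
  calc _ = ∫ x₁, ∫ x₂, ∫ q, g x₁ x₂ q.1 q.2 ∂(ν.prod f) ∂μ ∂μ := by
        simp_rw [fun x₁ x₂ => integral_prod _ (hin x₁ x₂)]
    _ = ∫ p, ∫ q, g p.1 p.2 q.1 q.2 ∂(ν.prod f) ∂(μ.prod μ) := (integral_prod _ hout).symm
    _ = ∫ q, ∫ p, g p.1 p.2 q.1 q.2 ∂(μ.prod μ) ∂(ν.prod f) :=
        integral_integral_swap (f := fun p q : ℝ × ℝ => g p.1 p.2 q.1 q.2) hint
    _ = ∫ s, ∫ y, ∫ p, g p.1 p.2 s y ∂(μ.prod μ) ∂f ∂ν := integral_prod _ hint.integral_prod_right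
    _ = _ := by
        refine integral_congr_ae ?_
        filter_upwards [hgh] with s hs
        refine integral_congr_ae (ae_of_all _ fun y => integral_prod_symm _ ?_)
        refine Integrable.of_bound (C := h s)
          (Measurable.aestronglyMeasurable (hg.comp (measurable_prodMk_right (y := (s, y)))))
          (ae_of_all _ fun p => hs _ _ _)

/-- The heat kernel of variance `t`, pulled back along a linear form on the unit square and
normalised by the scale `lam` of that form. -/
noncomputable def cellMass (τ a b t lam y : ℝ) : ℝ :=
  lam * ∫ x₂ in Set.Icc (0 : ℝ) 1, ∫ x₁ in Set.Icc (0 : ℝ) 1,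
    heat1 t ((lam / τ) * (b * x₂ - a * x₁) - y)

lemma setIntegral_Icc_zero_eq_mul {N : ℝ} (hN : 0 < N) (φ : ℝ → ℝ) :
    ∫ x in Set.Icc 0 N, φ x = N * ∫ x in Set.Icc (0 : ℝ) 1, φ (N * x) := by
  have h := intervalIntegral.smul_integral_comp_mul_left (a := 0) (b := 1) φ N
  rw [mul_zero, mul_one, smul_eq_mul] at h
  rw [integral_Icc_eq_integral_Ioc, integral_Icc_eq_integral_Ioc,
    ← intervalIntegral.integral_of_le hN.le, ← intervalIntegral.integral_of_le zero_le_one, h]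

section cellMass

variable {τ a b t lam y : ℝ}

lemma cellMass_eq (hτ : 0 < τ) (ha : 0 < a) (hlam : 0 < lam) :
    cellMass τ a b t lam y = τ / a * ∫ x₂ in Set.Icc (0 : ℝ) 1,
      ∫ w in (lam / τ * (b * x₂ - a) - y)..(lam / τ * (b * x₂) - y), heat1 t w := by
  have hc : lam / τ * a ≠ 0 := by positivity
  have h : ∀ x₂ : ℝ, ∫ x₁ in Set.Icc (0 : ℝ) 1, heat1 t ((lam / τ) * (b * x₂ - a * x₁) - y)
      = (lam / τ * a)⁻¹ *
        ∫ w in (lam / τ * (b * x₂ - a) - y)..(lam / τ * (b * x₂) - y), heat1 t w := by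
    intro x₂
    have h' := intervalIntegral.integral_comp_sub_mul (a := 0) (b := 1) (heat1 t) hc
      (lam / τ * (b * x₂) - y)
    rw [integral_Icc_eq_integral_Ioc, ← intervalIntegral.integral_of_le zero_le_one, ← smul_eq_mul]
    convert h' using 4 <;> ring_nf
  unfold cellMass
  simp_rw [h]
  rw [integral_const_mul, ← mul_assoc]
  congr 1
  field_simp

lemma cellMass_nonneg (ht : 0 ≤ t) (hlam : 0 ≤ lam) : 0 ≤ cellMass τ a b t lam y :=
  mul_nonneg hlam (integral_nonneg fun _ => integral_nonneg fun _ => heat1_nonneg ht _)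

lemma setIntegral_unit_le {φ : ℝ → ℝ} {C : ℝ} (h0 : ∀ x ∈ Set.Icc (0 : ℝ) 1, 0 ≤ φ x)
    (hC : ∀ x ∈ Set.Icc (0 : ℝ) 1, φ x ≤ C) :
    ∫ x in Set.Icc (0 : ℝ) 1, φ x ≤ C := by
  have h : ∫ x in Set.Icc (0 : ℝ) 1, φ x ≤ ∫ _ in Set.Icc (0 : ℝ) 1, C :=
    integral_mono_of_nonneg ((ae_restrict_mem measurableSet_Icc).mono fun x hx => h0 x hx)
      (integrable_const _) ((ae_restrict_mem measurableSet_Icc).mono fun x hx => hC x hx)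
  simpa using h

lemma cellMass_le (hτ : 0 < τ) (ha : 0 < a) (hlam : 0 < lam) (ht : 0 < t) :
    cellMass τ a b t lam y ≤ τ / a := by
  rw [cellMass_eq hτ ha hlam]
  have hab (x : ℝ) : lam / τ * (b * x - a) - y ≤ lam / τ * (b * x) - y := by
    gcongr
    linarith
  refine mul_le_of_le_one_right (by positivity) (setIntegral_unit_le ?_ ?_)
  · exact fun x _ => (intervalIntegral_heat1_mem ht (hab x)).1
  · exact fun x _ => (intervalIntegral_heat1_mem ht (hab x)).2

lemma cellMass_le_of_heat1_le {C : ℝ} (hlam : 0 ≤ lam) (ht : 0 ≤ t)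
    (hC : ∀ x₁ ∈ Set.Icc (0 : ℝ) 1, ∀ x₂ ∈ Set.Icc (0 : ℝ) 1,
      heat1 t ((lam / τ) * (b * x₂ - a * x₁) - y) ≤ C) :
    cellMass τ a b t lam y ≤ lam * C := by
  unfold cellMass
  gcongr
  refine setIntegral_unit_le (fun _ _ => integral_nonneg fun _ => heat1_nonneg ht _) fun x₂ h₂ =>
    setIntegral_unit_le (fun _ _ => heat1_nonneg ht _) fun x₁ h₁ => hC x₁ h₁ x₂ h₂

lemma measurable_cellMass :
    Measurable fun p : ℝ × ℝ × ℝ => cellMass τ a b p.1 p.2.1 p.2.2 := by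
  unfold cellMass
  refine (measurable_fst.comp measurable_snd).mul (StronglyMeasurable.measurable ?_)
  refine StronglyMeasurable.integral_prod_right ?_
  refine StronglyMeasurable.integral_prod_right ?_
  refine Measurable.stronglyMeasurable ?_
  exact measurable_heat1.comp (f := fun q : ((ℝ × ℝ × ℝ) × ℝ) × ℝ =>
    (q.1.1.1, q.1.1.2.1 / τ * (b * q.1.2 - a * q.2) - q.1.1.2.2)) (by fun_prop)

lemma tendsto_cellMass_of_atTop {ι : Type*} {l : Filter ι} [l.IsCountablyGenerated]
    {t lam : ι → ℝ} (hτ : 0 < τ) (hb : 0 < b) (hba : b ≤ a) (ht : Tendsto t l (𝓝[>] 0))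
    (hlam : Tendsto lam l atTop) :
    Tendsto (fun i => cellMass τ a b (t i) (lam i) y) l (𝓝 (τ / a)) := by
  have ha : 0 < a := hb.trans_le hba
  have ht0 : ∀ᶠ i in l, 0 < t i := ht.eventually self_mem_nhdsWithin
  have hsqrt : Tendsto (fun i => (√(t i))⁻¹) l atTop := by
    refine tendsto_inv_nhdsGT_zero.comp (tendsto_nhdsWithin_iff.mpr ⟨?_, ?_⟩)
    · simpa using (tendsto_nhdsWithin_iff.mp ht).1.sqrt
    · exact ht0.mono fun i hi => Real.sqrt_pos.mpr hi
  have hdiv : Tendsto (fun i => lam i / τ) l atTop := hlam.atTop_div_const hτ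
  have key : Tendsto (fun i => ∫ x₂ in Set.Icc (0 : ℝ) 1,
      ∫ w in (lam i / τ * (b * x₂ - a) - y)..(lam i / τ * (b * x₂) - y), heat1 (t i) w) l
      (𝓝 (∫ _ in Set.Icc (0 : ℝ) 1, (1 : ℝ))) := by
    refine tendsto_integral_filter_of_dominated_convergence (fun _ => 1) ?_ ?_
      (integrable_const _) ?_
    · filter_upwards [ht0] with i hi
      have hint := integrable_heat1 hi
      have hcont : Continuous fun x => ∫ w in (0 : ℝ)..x, heat1 (t i) w :=
        intervalIntegral.continuous_primitive (fun _ _ => hint.intervalIntegrable) 0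
      have heq : (fun x₂ => ∫ w in (lam i / τ * (b * x₂ - a) - y)..(lam i / τ * (b * x₂) - y),
          heat1 (t i) w) = fun x₂ => (∫ w in (0 : ℝ)..(lam i / τ * (b * x₂) - y), heat1 (t i) w)
            - ∫ w in (0 : ℝ)..(lam i / τ * (b * x₂ - a) - y), heat1 (t i) w := by
        funext x₂
        exact (intervalIntegral.integral_interval_sub_left hint.intervalIntegrable
          hint.intervalIntegrable).symm
      rw [heq]
      exact Continuous.aestronglyMeasurable
        ((hcont.comp (by fun_prop)).sub (hcont.comp (by fun_prop)))
    · filter_upwards [ht0, hdiv.eventually_ge_atTop 0] with i hi hl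
      refine ae_of_all _ fun x => ?_
      have hab : lam i / τ * (b * x - a) - y ≤ lam i / τ * (b * x) - y := by
        gcongr
        linarith
      have h := intervalIntegral_heat1_mem hi hab
      rw [Real.norm_of_nonneg h.1]
      exact h.2
    · filter_upwards [ae_restrict_mem measurableSet_Icc,
        ae_restrict_of_ae (Measure.ae_ne volume 0), ae_restrict_of_ae (Measure.ae_ne volume 1)]
        with x hx h0 h1
      have hx0 : 0 < b * x := mul_pos hb (lt_of_le_of_ne hx.1 h0.symm)
      have hx1 : b * x - a < 0 := by nlinarith [lt_of_le_of_ne hx.2 h1]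
      refine tendsto_intervalIntegral_heat1 ht0 ?_ ?_
      · exact (tendsto_atBot_add_const_right l (-y)
          (hdiv.atTop_mul_const_of_neg hx1)).atBot_mul_atTop₀ hsqrt
      · exact (tendsto_atTop_add_const_right l (-y)
          (hdiv.atTop_mul_const hx0)).atTop_mul_atTop₀ hsqrt
  have key' := key.const_mul (τ / a)
  simp only [integral_const, measureReal_restrict_apply_univ, Real.volume_real_Icc, smul_eq_mul,
    sub_zero, max_eq_left zero_le_one, mul_one] at key'
  refine key'.congr' ?_
  filter_upwards [hlam.eventually_gt_atTop 0] with i hi using (cellMass_eq hτ ha hi).symm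

lemma tendsto_cellMass_of_zero {ι : Type*} {l : Filter ι}
    {t lam : ι → ℝ} (hy : y ≠ 0) (ht : ∀ᶠ i in l, 0 < t i) (hlam0 : ∀ᶠ i in l, 0 < lam i)
    (hlam : Tendsto lam l (𝓝 0)) :
    Tendsto (fun i => cellMass τ a b (t i) (lam i) y) l (𝓝 0) := by
  have hy' : 0 < |y| := abs_pos.mpr hy
  have hsmall : ∀ᶠ i in l, |lam i / τ| * (|b| + |a|) < |y| / 2 := by
    have h : Tendsto (fun i => |lam i / τ| * (|b| + |a|)) l (𝓝 0) := by
      simpa using ((hlam.div_const τ).abs).mul_const (|b| + |a|)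
    exact h.eventually_lt_const (by positivity)
  refine tendsto_of_tendsto_of_tendsto_of_le_of_le' tendsto_const_nhds
    (h := fun i => lam i * (|y| / 2)⁻¹) (by simpa using hlam.mul_const (|y| / 2)⁻¹) ?_ ?_
  · filter_upwards [ht, hlam0] with i h1 h2 using cellMass_nonneg h1.le h2.le
  · filter_upwards [ht, hlam0, hsmall] with i h1 h2 h3
    refine cellMass_le_of_heat1_le h2.le h1.le fun x₁ hx₁ x₂ hx₂ => ?_
    have hw : |lam i / τ * (b * x₂ - a * x₁)| ≤ |lam i / τ| * (|b| + |a|) := by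
      rw [abs_mul]
      gcongr
      refine (abs_sub _ _).trans ?_
      rw [abs_mul, abs_mul, abs_of_nonneg hx₁.1, abs_of_nonneg hx₂.1]
      gcongr
      · exact mul_le_of_le_one_right (abs_nonneg _) hx₂.2
      · exact mul_le_of_le_one_right (abs_nonneg _) hx₁.2
    have hge : |y| / 2 ≤ |lam i / τ * (b * x₂ - a * x₁) - y| := by
      have := abs_sub_abs_le_abs_sub y (lam i / τ * (b * x₂ - a * x₁))
      rw [abs_sub_comm]
      linarith
    have hne : lam i / τ * (b * x₂ - a * x₁) - y ≠ 0 := by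
      rw [← abs_pos]
      linarith
    refine (heat1_le_inv_abs h1 hne).trans ?_
    gcongr

end cellMass

/-- A finite measure whose Fourier transform vanishes at infinity does not charge the origin. -/
lemma measure_singleton_zero_of_tendsto_charFun {f : Measure ℝ} [IsFiniteMeasure f]
    (h : Tendsto (charFun f) (cocompact ℝ) (𝓝 0)) : f {0} = 0 := by
  set γ := ProbabilityTheory.gaussianReal 0 1
  have hswap : ∀ R : ℝ, ∫ z, charFun f (R * z) ∂γ
      = ((∫ y, Real.exp (-(R * y) ^ 2 / 2) ∂f : ℝ) : ℂ) := by
    intro R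
    have hint : Integrable (Function.uncurry fun z y : ℝ => Complex.exp (↑(R * z) * y * Complex.I))
        (γ.prod f) := by
      refine Integrable.of_bound (C := 1)
        (Measurable.aestronglyMeasurable (by unfold Function.uncurry; fun_prop))
        (ae_of_all _ fun p => ?_)
      rw [Function.uncurry, ← Complex.ofReal_mul, Complex.norm_exp_ofReal_mul_I]
    simp_rw [charFun_apply_real]
    rw [integral_integral_swap hint, ← integral_complex_ofReal]
    refine integral_congr_ae (ae_of_all _ fun y => ?_)
    have hγ := ProbabilityTheory.charFun_gaussianReal (μ := 0) (v := 1) (R * y)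
    rw [charFun_apply_real] at hγ
    simp only
    convert hγ using 1
    · refine integral_congr_ae (ae_of_all _ fun z => ?_)
      push_cast
      ring_nf
    · push_cast
      simp
      ring_nf
  have hlim : Tendsto (fun R : ℝ => ∫ z, charFun f (R * z) ∂γ) atTop (𝓝 (∫ _, (0 : ℂ) ∂γ)) := by
    refine tendsto_integral_filter_of_dominated_convergence (fun _ => f.real Set.univ) ?_ ?_
      (integrable_const _) ?_
    · exact Eventually.of_forall fun R =>
        (measurable_charFun.comp (measurable_const_mul R)).aestronglyMeasurable
    · exact Eventually.of_forall fun R => ae_of_all _ fun z => norm_charFun_le _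
    · have : NullSingletonClass γ :=
        ProbabilityTheory.nullSingletonClass_gaussianReal one_ne_zero
      filter_upwards [Measure.ae_ne γ 0] with z hz
      refine h.comp ?_
      rcases lt_or_gt_of_ne hz with hz | hz
      · exact (tendsto_id.atTop_mul_const_of_neg hz).mono_right atBot_le_cocompact
      · exact (tendsto_id.atTop_mul_const hz).mono_right atTop_le_cocompact
  have hlim' : Tendsto (fun R : ℝ => ∫ y, Real.exp (-(R * y) ^ 2 / 2) ∂f) atTop (𝓝 0) := by
    simp_rw [hswap, integral_zero] at hlim
    rw [← Complex.ofReal_zero] at hlim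
    exact (tendsto_ofReal_iff).mp hlim
  have hle : ∀ R : ℝ, f.real {0} ≤ ∫ y, Real.exp (-(R * y) ^ 2 / 2) ∂f := by
    intro R
    rw [← integral_indicator_one (measurableSet_singleton 0)]
    refine integral_mono ((integrable_const 1).indicator (measurableSet_singleton 0)) ?_ ?_
    · refine Integrable.of_bound (C := 1)
        (Measurable.aestronglyMeasurable (by fun_prop)) (ae_of_all _ fun y => ?_)
      rw [Real.norm_of_nonneg (Real.exp_pos _).le, Real.exp_le_one_iff]
      nlinarith [sq_nonneg (R * y)]
    · intro y
      by_cases hy : y = 0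
      · simp [hy]
      · simp [hy, Real.exp_nonneg]
  have h0 : f.real {0} = 0 := le_antisymm (ge_of_tendsto' hlim' hle) measureReal_nonneg
  exact (measureReal_eq_zero_iff).mp h0

lemma setIntegral_Ioo_zero_eq_integral_exp {L c : ℝ} (hL : 0 < L) (k : ℝ → ℝ) :
    ∫ s in Set.Ioo 0 c, k s = ∫ θ in {θ | Real.exp (-(L * θ)) < c},
      L * Real.exp (-(L * θ)) * k (Real.exp (-(L * θ))) := by
  have himg : Set.Ioo 0 c = (fun θ => Real.exp (-(L * θ))) '' {θ | Real.exp (-(L * θ)) < c} := by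
    ext s
    constructor
    · rintro ⟨h0, h1⟩
      have : Real.exp (-(L * (-Real.log s / L))) = s := by
        rw [mul_div_cancel₀ _ hL.ne', neg_neg, Real.exp_log h0]
      exact ⟨-Real.log s / L, by simpa [this] using h1, this⟩
    · rintro ⟨θ, h1, rfl⟩
      exact ⟨Real.exp_pos _, h1⟩
  have hS : MeasurableSet {θ : ℝ | Real.exp (-(L * θ)) < c} :=
    measurableSet_lt (by fun_prop) measurable_const
  rw [himg, integral_image_eq_integral_abs_deriv_smul hS
    (f' := fun θ => Real.exp (-(L * θ)) * (-(L * 1)))]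
  · refine integral_congr_ae (ae_of_all _ fun θ => ?_)
    simp only [smul_eq_mul]
    rw [abs_mul, abs_neg, mul_one, abs_of_pos hL, abs_of_pos (Real.exp_pos _)]
    ring
  · exact fun θ _ => ((((hasDerivAt_id θ).const_mul L).neg).exp).hasDerivWithinAt
  · intro x _ y _ hxy
    have := Real.exp_injective hxy
    exact mul_left_cancel₀ hL.ne' (neg_injective this)

/-- The variance `2 s (τ - s) / τ` dominates the distance of `s` to the ends of `[0, τ]`. -/
lemma min_le_bridge_variance {τ s : ℝ} (hτ : 0 < τ) (h0 : 0 ≤ s) (h1 : s ≤ τ) :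
    min s (τ - s) ≤ 2 * s * (τ - s) / τ := by
  rw [le_div_iff₀ hτ]
  rcases le_total s (τ - s) with h | h
  · rw [min_eq_left h]
    nlinarith
  · rw [min_eq_right h]
    nlinarith

lemma heat1_bridge_le {τ s : ℝ} (h0 : 0 < s) (h1 : s < τ) (x : ℝ) :
    heat1 (2 * s * (τ - s) / τ) x ≤ s ^ (-(1 / 2) : ℝ) + (τ - s) ^ (-(1 / 2) : ℝ) := by
  have hτ : 0 < τ := h0.trans h1
  have h1' : 0 < τ - s := sub_pos.mpr h1
  have hm := min_le_bridge_variance hτ h0.le h1.le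
  have hpos : 0 < min s (τ - s) := lt_min h0 h1'
  have e (u : ℝ) (hu : 0 < u) : u ^ (-(1 / 2) : ℝ) = (√u)⁻¹ := by
    rw [Real.rpow_neg hu.le, Real.sqrt_eq_rpow]
  rw [e _ h0, e _ h1']
  calc _ ≤ (√(2 * s * (τ - s) / τ))⁻¹ := heat1_le (hpos.le.trans hm) x
    _ ≤ (√(min s (τ - s)))⁻¹ := by gcongr
    _ ≤ _ := by
      rcases min_choice s (τ - s) with h | h <;> rw [h]
      · exact le_add_of_nonneg_right (by positivity)
      · exact le_add_of_nonneg_left (by positivity)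

lemma integrableOn_bridge_bound {τ c : ℝ} (hτ : 0 < τ) (hc : c ≤ τ) :
    IntegrableOn (fun s : ℝ => s ^ (-(1 / 2) : ℝ) + (τ - s) ^ (-(1 / 2) : ℝ)) (Set.Ioo 0 c) := by
  have h1 : IntervalIntegrable (fun s : ℝ => s ^ (-(1 / 2) : ℝ)) volume 0 τ :=
    intervalIntegral.intervalIntegrable_rpow' (by norm_num)
  have h2 : IntervalIntegrable (fun s : ℝ => (τ - s) ^ (-(1 / 2) : ℝ)) volume 0 τ := by
    simpa using (h1.comp_sub_left τ).symm
  exact ((intervalIntegrable_iff_integrableOn_Ioo_of_le hτ.le).mp (h1.add h2)).mono_set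
    (Set.Ioo_subset_Ioo_right hc)

lemma integral_square_bridge_eq {f : Measure ℝ} [IsFiniteMeasure f] {τ a b c L : ℝ}
    (hτ : 0 < τ) (hc : c ≤ τ) (hL : 0 < L) :
    Real.exp L / L * ((Real.exp L ^ 2)⁻¹ *
      ∫ x₁ in Set.Icc (0 : ℝ) (Real.exp L), ∫ x₂ in Set.Icc (0 : ℝ) (Real.exp L),
        ∫ s in Set.Ioo (0 : ℝ) c,
          ∫ y, heat1 (2 * s * (τ - s) / τ) ((s / τ) * (b * x₂ - a * x₁) - y) ∂f)
    = ∫ θ, {θ | Real.exp (-(L * θ)) < c}.indicator (fun θ => ∫ y,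
        cellMass τ a b (2 * Real.exp (-(L * θ)) * (τ - Real.exp (-(L * θ))) / τ)
          (Real.exp L * Real.exp (-(L * θ))) y ∂f) θ := by
  set N := Real.exp L
  have hN : 0 < N := Real.exp_pos L
  have hmeas : Measurable fun p : (ℝ × ℝ) × (ℝ × ℝ) =>
      heat1 (2 * p.2.1 * (τ - p.2.1) / τ) ((p.2.1 / τ) * (b * p.1.2 - a * p.1.1) - p.2.2) :=
    measurable_heat1.comp (f := fun p : (ℝ × ℝ) × (ℝ × ℝ) => (2 * p.2.1 * (τ - p.2.1) / τ,
      (p.2.1 / τ) * (b * p.1.2 - a * p.1.1) - p.2.2)) (by fun_prop)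
  have hbound : ∀ᵐ s ∂(volume.restrict (Set.Ioo 0 c)), ∀ x₁ x₂ y : ℝ,
      ‖heat1 (2 * s * (τ - s) / τ) ((s / τ) * (b * x₂ - a * x₁) - y)‖
        ≤ s ^ (-(1 / 2) : ℝ) + (τ - s) ^ (-(1 / 2) : ℝ) := by
    filter_upwards [ae_restrict_mem measurableSet_Ioo] with s hs x₁ x₂ y
    have hs1 : 0 < τ - s := sub_pos.mpr (hs.2.trans_le hc)
    have hs0 := hs.1
    rw [Real.norm_of_nonneg (heat1_nonneg (by positivity) _)]
    exact heat1_bridge_le hs.1 (hs.2.trans_le hc) _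
  rw [integral_swap_four (μ := volume.restrict (Set.Icc 0 N)) hmeas
    (integrableOn_bridge_bound hτ hc) hbound, setIntegral_Ioo_zero_eq_integral_exp hL,
    ← mul_assoc, ← integral_const_mul, integral_indicator
      (measurableSet_lt (by fun_prop) measurable_const)]
  refine integral_congr_ae (ae_of_all _ fun θ => ?_)
  simp only
  set s := Real.exp (-(L * θ))
  rw [← integral_const_mul, ← integral_const_mul]
  refine integral_congr_ae (ae_of_all _ fun y => ?_)
  simp only [cellMass]
  simp_rw [setIntegral_Icc_zero_eq_mul hN, integral_const_mul]
  have harg (x₁ x₂ : ℝ) : s / τ * (b * (N * x₂) - a * (N * x₁)) - y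
      = N * s / τ * (b * x₂ - a * x₁) - y := by ring
  simp_rw [harg]
  field_simp

lemma integrable_cellMass {f : Measure ℝ} [IsFiniteMeasure f] {τ a b t lam : ℝ} (hτ : 0 < τ)
    (ha : 0 < a) (hlam : 0 < lam) (ht : 0 < t) : Integrable (cellMass τ a b t lam) f := by
  refine Integrable.of_bound (C := τ / a) (Measurable.aestronglyMeasurable ?_)
    (ae_of_all _ fun y => ?_)
  · exact measurable_cellMass.comp (f := fun y : ℝ => (t, lam, y)) (by fun_prop)
  · rw [Real.norm_of_nonneg (cellMass_nonneg ht.le hlam.le)]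
    exact cellMass_le hτ ha hlam ht

lemma tendsto_integral_cellMass_of_atTop {ι : Type*} {l : Filter ι} [l.IsCountablyGenerated]
    {f : Measure ℝ} [IsFiniteMeasure f] {τ a b : ℝ} {t lam : ι → ℝ} (hτ : 0 < τ) (hb : 0 < b)
    (hba : b ≤ a) (ht : Tendsto t l (𝓝[>] 0)) (hlam : Tendsto lam l atTop) :
    Tendsto (fun i => ∫ y, cellMass τ a b (t i) (lam i) y ∂f) l
      (𝓝 (τ / a * f.real Set.univ)) := by
  have ha : 0 < a := hb.trans_le hba
  have ht0 : ∀ᶠ i in l, 0 < t i := ht.eventually self_mem_nhdsWithin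
  have h := tendsto_integral_filter_of_dominated_convergence (μ := f) (l := l)
    (F := fun i y => cellMass τ a b (t i) (lam i) y) (f := fun _ => τ / a) (fun _ => τ / a) ?_ ?_
    (integrable_const _) (ae_of_all _ fun y => tendsto_cellMass_of_atTop hτ hb hba ht hlam)
  · simpa [mul_comm] using h
  · filter_upwards [ht0, hlam.eventually_gt_atTop 0] with i h1 h2
      using (integrable_cellMass hτ ha h2 h1).aestronglyMeasurable
  · filter_upwards [ht0, hlam.eventually_gt_atTop 0] with i h1 h2
    refine ae_of_all _ fun y => ?_
    rw [Real.norm_of_nonneg (cellMass_nonneg h1.le h2.le)]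
    exact cellMass_le hτ ha h2 h1

lemma tendsto_integral_cellMass_of_zero {ι : Type*} {l : Filter ι} [l.IsCountablyGenerated]
    {f : Measure ℝ} [IsFiniteMeasure f] (hf : f {0} = 0) {τ a b : ℝ} {t lam : ι → ℝ}
    (hτ : 0 < τ) (ha : 0 < a) (ht0 : ∀ᶠ i in l, 0 < t i) (hlam0 : ∀ᶠ i in l, 0 < lam i)
    (hlam : Tendsto lam l (𝓝 0)) :
    Tendsto (fun i => ∫ y, cellMass τ a b (t i) (lam i) y ∂f) l (𝓝 0) := by
  rw [← integral_zero ℝ ℝ (μ := f)]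
  refine tendsto_integral_filter_of_dominated_convergence (fun _ => τ / a) ?_ ?_
    (integrable_const _) ?_
  · filter_upwards [ht0, hlam0] with i h1 h2
      using (integrable_cellMass hτ ha h2 h1).aestronglyMeasurable
  · filter_upwards [ht0, hlam0] with i h1 h2
    refine ae_of_all _ fun y => ?_
    rw [Real.norm_of_nonneg (cellMass_nonneg h1.le h2.le)]
    exact cellMass_le hτ ha h2 h1
  · have hne : ∀ᵐ y ∂f, y ≠ 0 := by
      rw [ae_iff]
      simpa using hf
    filter_upwards [hne] with y hy using tendsto_cellMass_of_zero hy ht0 hlam0 hlam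

lemma tendsto_integral_bridge_cellMass {f : Measure ℝ} [IsFiniteMeasure f] (hf : f {0} = 0)
    {τ a b c : ℝ} (hτ : 0 < τ) (hb : 0 < b) (hba : b ≤ a) (hc0 : 0 < c) (hc : c ≤ τ) :
    Tendsto (fun L : ℝ => ∫ θ, {θ | Real.exp (-(L * θ)) < c}.indicator (fun θ => ∫ y,
        cellMass τ a b (2 * Real.exp (-(L * θ)) * (τ - Real.exp (-(L * θ))) / τ)
          (Real.exp L * Real.exp (-(L * θ))) y ∂f) θ) atTop (𝓝 (τ / a * f.real Set.univ)) := by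
  have ha : 0 < a := hb.trans_le hba
  have hvar : ∀ {s : ℝ}, 0 < s → s < c → 0 < 2 * s * (τ - s) / τ := fun {s} h0 h1 => by
    have : 0 < τ - s := by linarith
    positivity
  have hexp_mul (L θ : ℝ) : Real.exp L * Real.exp (-(L * θ)) = Real.exp (L * (1 - θ)) := by
    rw [← Real.exp_add]
    ring_nf
  have hval : ∫ θ, (Set.Ioo (0 : ℝ) 1).indicator (fun _ => τ / a * f.real Set.univ) θ
      = τ / a * f.real Set.univ := by
    rw [integral_indicator measurableSet_Ioo]
    simp
  rw [← hval]
  refine tendsto_integral_filter_of_dominated_convergence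
    ((Set.Ioi (-1)).indicator fun θ => (τ / a + 1) * f.real Set.univ * Real.exp (1 - θ / 2))
    ?_ ?_ ?_ ?_
  · refine Eventually.of_forall fun L => StronglyMeasurable.aestronglyMeasurable
      (StronglyMeasurable.indicator ?_ (measurableSet_lt (by fun_prop) measurable_const))
    refine StronglyMeasurable.integral_prod_right ?_
    exact (measurable_cellMass.comp (f := fun q : ℝ × ℝ =>
      (2 * Real.exp (-(L * q.1)) * (τ - Real.exp (-(L * q.1))) / τ,
        Real.exp L * Real.exp (-(L * q.1)), q.2)) (by fun_prop)).stronglyMeasurable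
  · have h1 : ∀ᶠ L : ℝ in atTop, c ≤ Real.exp L := Real.tendsto_exp_atTop.eventually_ge_atTop c
    have h2 : ∀ᶠ L : ℝ in atTop, Real.exp (-(2 * L)) ≤ τ / 2 := by
      have h : Tendsto (fun L : ℝ => Real.exp (-(2 * L))) atTop (𝓝 0) :=
        Real.tendsto_exp_neg_atTop_nhds_zero.comp (tendsto_id.const_mul_atTop two_pos)
      exact h.eventually_le_const (by positivity)
    filter_upwards [h1, h2, eventually_ge_atTop 1] with L hL1 hL2 hL
    refine ae_of_all _ fun θ => ?_
    by_cases hθc : Real.exp (-(L * θ)) < c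
    swap
    · rw [Set.indicator_of_notMem (by simpa using hθc), norm_zero]
      exact Set.indicator_nonneg (fun _ _ => by positivity) _
    have hθ : -1 < θ := by
      by_contra! h
      have : Real.exp L ≤ Real.exp (-(L * θ)) := Real.exp_le_exp.mpr (by nlinarith)
      linarith
    rw [Set.indicator_of_mem (by simpa using hθc), Set.indicator_of_mem (by simpa using hθ)]
    set s := Real.exp (-(L * θ)) with hs
    have hs0 : 0 < s := Real.exp_pos _
    have hv := hvar hs0 hθc
    have hlam : 0 < Real.exp L * s := by positivity
    rw [Real.norm_of_nonneg (integral_nonneg fun y => cellMass_nonneg hv.le hlam.le)]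
    have key : ∀ y, cellMass τ a b (2 * s * (τ - s) / τ) (Real.exp L * s) y
        ≤ (τ / a + 1) * Real.exp (1 - θ / 2) := by
      intro y
      rcases le_total θ 2 with h | h
      · have he : 1 ≤ Real.exp (1 - θ / 2) := Real.one_le_exp (by linarith)
        have hK := cellMass_le (b := b) (y := y) hτ ha hlam hv
        have : 0 < τ / a := by positivity
        nlinarith
      · have hsmall : s ≤ τ / 2 := (Real.exp_le_exp.mpr (by nlinarith)).trans hL2
        have hsv : s ≤ 2 * s * (τ - s) / τ := by
          have := min_le_bridge_variance hτ hs0.le (by linarith : s ≤ τ)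
          rwa [min_eq_left (by linarith)] at this
        have hsq : √s = Real.exp (-(L * θ) / 2) := by rw [hs, Real.exp_half]
        have hK : cellMass τ a b (2 * s * (τ - s) / τ) (Real.exp L * s) y
            ≤ Real.exp L * s * (√s)⁻¹ :=
          cellMass_le_of_heat1_le hlam.le hv.le fun _ _ _ _ =>
            (heat1_le hv.le _).trans (by gcongr)
        have he : Real.exp L * s * (√s)⁻¹ = Real.exp (L * (1 - θ / 2)) := by
          rw [hsq, hs, ← Real.exp_neg, ← Real.exp_add, ← Real.exp_add]
          ring_nf
        have he' : Real.exp (L * (1 - θ / 2)) ≤ Real.exp (1 - θ / 2) :=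
          Real.exp_le_exp.mpr (by nlinarith)
        have : 0 ≤ τ / a * Real.exp (1 - θ / 2) := by positivity
        linarith
    calc _ ≤ ∫ _, (τ / a + 1) * Real.exp (1 - θ / 2) ∂f :=
          integral_mono (integrable_cellMass hτ ha hlam hv) (integrable_const _) key
      _ = _ := by
        rw [integral_const, smul_eq_mul]
        ring
  · rw [integrable_indicator_iff measurableSet_Ioi]
    refine Integrable.const_mul ?_ _
    refine ((integrableOn_exp_mul_Ioi (a := -1 / 2) (by norm_num) (-1)).const_mul
      (Real.exp 1)).congr (ae_of_all _ fun θ => ?_)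
    simp only
    rw [← Real.exp_add]
    ring_nf
  · filter_upwards [Measure.ae_ne volume 0, Measure.ae_ne volume 1] with θ h0 h1
    have hs_zero (hθ : 0 < θ) : Tendsto (fun L : ℝ => Real.exp (-(L * θ))) atTop (𝓝 0) :=
      Real.tendsto_exp_neg_atTop_nhds_zero.comp (tendsto_id.atTop_mul_const hθ)
    rcases lt_or_gt_of_ne h0 with hθ | hθ
    · rw [Set.indicator_of_notMem (by simp [hθ.le])]
      have hlarge : Tendsto (fun L : ℝ => Real.exp (-(L * θ))) atTop atTop :=
        Real.tendsto_exp_atTop.comp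
          (tendsto_neg_atBot_atTop.comp (tendsto_id.atTop_mul_const_of_neg hθ))
      refine tendsto_const_nhds.congr' ?_
      filter_upwards [hlarge.eventually_ge_atTop c] with L hL
      rw [Set.indicator_of_notMem (by simpa using hL)]
    have hsc : ∀ᶠ L : ℝ in atTop, Real.exp (-(L * θ)) < c := (hs_zero hθ).eventually_lt_const hc0
    have hv0 : ∀ᶠ L : ℝ in atTop,
        0 < 2 * Real.exp (-(L * θ)) * (τ - Real.exp (-(L * θ))) / τ :=
      hsc.mono fun L hL => hvar (Real.exp_pos _) hL
    suffices h : Tendsto (fun L : ℝ => ∫ y,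
        cellMass τ a b (2 * Real.exp (-(L * θ)) * (τ - Real.exp (-(L * θ))) / τ)
          (Real.exp L * Real.exp (-(L * θ))) y ∂f) atTop
        (𝓝 ((Set.Ioo (0 : ℝ) 1).indicator (fun _ => τ / a * f.real Set.univ) θ)) by
      refine h.congr' ?_
      filter_upwards [hsc] with L hL
      rw [Set.indicator_of_mem (by simpa using hL)]
    simp_rw [hexp_mul]
    rcases lt_or_gt_of_ne h1 with h1 | h1
    · rw [Set.indicator_of_mem (show θ ∈ Set.Ioo (0 : ℝ) 1 from ⟨hθ, h1⟩)]
      refine tendsto_integral_cellMass_of_atTop hτ hb hba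
        (tendsto_nhdsWithin_iff.mpr ⟨?_, hv0⟩) ?_
      · have h := (((hs_zero hθ).const_mul 2).mul ((hs_zero hθ).const_sub τ)).div_const τ
        simpa using h
      · exact Real.tendsto_exp_atTop.comp (tendsto_id.atTop_mul_const (sub_pos.mpr h1))
    · rw [Set.indicator_of_notMem (by simp [h1.le])]
      refine tendsto_integral_cellMass_of_zero hf hτ ha hv0
        (Eventually.of_forall fun L => Real.exp_pos _) ?_
      exact Real.tendsto_exp_atBot.comp
        (tendsto_id.atTop_mul_const_of_neg (sub_neg.mpr h1))

/-- If `f` is a finite nonnegative Rajchman measure on `ℝ` (its Fourier transform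
`f̂(x) = ∫ e^{ixy} f(dy)` tends to `0` as `|x| → ∞`) and `0 < t₁ ≤ t₂`, then
`lim_{N→∞} (N / log N) V_N = t₁ f(ℝ)`. -/
theorem stmt_11 (f : Measure ℝ) [IsFiniteMeasure f]
    (hRaj : Filter.Tendsto (fun x : ℝ => ∫ y, Complex.exp (Complex.I * x * y) ∂f)
      (Filter.cocompact ℝ) (nhds 0))
    (t₁ t₂ : ℝ) (h1 : 0 < t₁) (h12 : t₁ ≤ t₂) :
    Filter.Tendsto (fun N : ℝ => (N / Real.log N) * VN f t₁ t₂ N) Filter.atTop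
      (nhds (t₁ * (f Set.univ).toReal)) := by
  have h2 : 0 < t₂ := h1.trans_le h12
  have hf : f {0} = 0 := by
    refine measure_singleton_zero_of_tendsto_charFun (hRaj.congr fun x => ?_)
    rw [charFun_apply_real]
    refine integral_congr_ae (ae_of_all _ fun y => ?_)
    simp only
    ring_nf
  have hτ : 0 < 2 * t₁ * t₂ / (t₁ + t₂) := by positivity
  have hc : t₁ ≤ 2 * t₁ * t₂ / (t₁ + t₂) := by
    rw [le_div_iff₀ (by positivity)]
    nlinarith
  have hba : 2 * t₁ / (t₁ + t₂) ≤ 2 * t₂ / (t₁ + t₂) := by gcongr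
  have h := tendsto_integral_bridge_cellMass hf hτ
    (show 0 < 2 * t₁ / (t₁ + t₂) by positivity) hba h1 hc
  have hdiv : 2 * t₁ * t₂ / (t₁ + t₂) / (2 * t₂ / (t₁ + t₂)) = t₁ := by field_simp
  rw [hdiv] at h
  refine (h.comp Real.tendsto_log_atTop).congr' ?_
  filter_upwards [eventually_gt_atTop 1] with N hN
  have hlog : 0 < Real.log N := Real.log_pos hN
  rw [Function.comp_apply, ← integral_square_bridge_eq hτ hc hlog,
    Real.exp_log (zero_lt_one.trans hN)]
  rfl
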